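/- arXiv:1707.05669 — 3 statements merged into one kernel-verified Lean document; each statement's English description precedes it below -/
import Mathlib

section
/- For all F, G ∈ B(𝔥⊕𝔎) and β ∈ ℝ: (i) if G = Δ⊥GΔ⊥ then (G ⋄ F)* ⋄ (G ⋄ F) = F* ⋄ F + G* + G; (ii) if G* ⋄ G ≤ 2βΔ⊥ then (G ⋄ F)* ⋄ (G ⋄ F) ≤ F* ⋄ F + 2βΔ⊥; (iii) if G* ⋄ G = 0 then (G ⋄ F)* ⋄ (G ⋄ F) = F* ⋄ F. Consequently, each of the following classes is closed under the series product: 𝔠 := {F : F* ⋄ F ≤ 0}, 𝔦 := {F : F* ⋄ F = 0}, 𝔲 := {F : F* ⋄ F = 0 = F ⋄ F*}, and 𝔮𝔠 := {F : F* ⋄ F ≤ 2βΔ⊥ for some β ∈ ℝ} (in the quantified sense that F₁* ⋄ F₁ ≤ 2β₁Δ⊥ and F₂* ⋄ F₂ ≤ 2β₂Δ⊥ imply (F₁ ⋄ F₂)* ⋄ (F₁ ⋄ F₂) ≤ 2(β₁+β₂)Δ⊥). -/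
noncomputable section

open ContinuousLinearMap

namespace QS

variable (H K : Type*) [NormedAddCommGroup H] [InnerProductSpace ℂ H] [CompleteSpace H]
  [NormedAddCommGroup K] [InnerProductSpace ℂ K] [CompleteSpace K]

/-- The Hilbert space direct sum `𝔥 ⊕ 𝔎`. -/
abbrev E := WithLp 2 (H × K)

def eE : E H K ≃L[ℂ] H × K := WithLp.prodContinuousLinearEquiv 2 ℂ H K

/-- Inclusion of `𝔥` into `𝔥 ⊕ 𝔎`. -/
def inH : H →L[ℂ] E H K := ((eE H K).symm : H × K →L[ℂ] E H K).comp (ContinuousLinearMap.inl ℂ H K)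

/-- Inclusion of `𝔎` into `𝔥 ⊕ 𝔎`. -/
def inK : K →L[ℂ] E H K := ((eE H K).symm : H × K →L[ℂ] E H K).comp (ContinuousLinearMap.inr ℂ H K)

/-- Projection of `𝔥 ⊕ 𝔎` onto `𝔥`. -/
def prH : E H K →L[ℂ] H := (ContinuousLinearMap.fst ℂ H K).comp ((eE H K) : E H K →L[ℂ] H × K)

/-- Projection of `𝔥 ⊕ 𝔎` onto `𝔎`. -/
def prK : E H K →L[ℂ] K := (ContinuousLinearMap.snd ℂ H K).comp ((eE H K) : E H K →L[ℂ] H × K)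

/-- `Δ`, the orthogonal projection onto `{0} ⊕ 𝔎`. -/
def Dl : E H K →L[ℂ] E H K := (inK H K).comp (prK H K)

/-- `Δ⊥ = I - Δ`. -/
def Dp : E H K →L[ℂ] E H K := 1 - Dl H K

variable {H K}

/-- The series product `F₁ ⋄ F₂ := F₁ + F₁ Δ F₂ + F₂`. -/
def sp (F₁ F₂ : E H K →L[ℂ] E H K) : E H K →L[ℂ] E H K := F₁ + F₁ * Dl H K * F₂ + F₂

/-- Operator order: `S ≤ T` iff `T - S` is a nonnegative selfadjoint operator. -/
def opLe (S T : E H K →L[ℂ] E H K) : Prop := (T - S).IsPositive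

/-- `F` has block matrix form `[K, M; L, N]`, i.e. `F (u ⊕ ζ) = (K u + M ζ) ⊕ (L u + N ζ)`. -/
def HasBlock (F : E H K →L[ℂ] E H K) (Kc : H →L[ℂ] H) (M : K →L[ℂ] H)
    (L : H →L[ℂ] K) (N : K →L[ℂ] K) : Prop :=
  ∀ (u : H) (ζ : K), F ((WithLp.equiv 2 (H × K)).symm (u, ζ)) =
    (WithLp.equiv 2 (H × K)).symm (Kc u + M ζ, L u + N ζ)

/-- The operator on `𝔥 ⊕ 𝔎` with block matrix form `[K, M; L, N]`. -/
def blockOf (Kc : H →L[ℂ] H) (M : K →L[ℂ] H) (L : H →L[ℂ] K) (N : K →L[ℂ] K) :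
    E H K →L[ℂ] E H K :=
  (inH H K) ∘L Kc ∘L (prH H K) + (inH H K) ∘L M ∘L (prK H K) +
    (inK H K) ∘L L ∘L (prH H K) + (inK H K) ∘L N ∘L (prK H K)

lemma Dl_mul_Dl : Dl H K * Dl H K = Dl H K := by
  ext x
  simp [Dl, inK, prK, eE]

lemma adjoint_Dl : adjoint (Dl H K) = Dl H K := by
  refine (ContinuousLinearMap.eq_adjoint_iff _ _ |>.mpr fun x y => ?_).symm
  simp [Dl, inK, prK, eE, WithLp.prod_inner_apply]

lemma Dl_mul_Dp : Dl H K * Dp H K = 0 := by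
  rw [Dp, mul_sub, mul_one, Dl_mul_Dl, sub_self]

lemma Dp_mul_Dl : Dp H K * Dl H K = 0 := by
  rw [Dp, sub_mul, one_mul, Dl_mul_Dl, sub_self]

lemma adjoint_mul (A B : E H K →L[ℂ] E H K) : adjoint (A * B) = adjoint B * adjoint A :=
  adjoint_comp A B

lemma adjoint_sp (F G : E H K →L[ℂ] E H K) :
    adjoint (sp F G) = sp (adjoint G) (adjoint F) := by
  simp only [sp, map_add, adjoint_mul, adjoint_Dl, mul_assoc]
  abel

lemma adjoint_one_add_Dl_mul (F : E H K →L[ℂ] E H K) :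
    adjoint (1 + Dl H K * F) = 1 + adjoint F * Dl H K := by
  rw [map_add, adjoint_mul, adjoint_Dl, ← star_eq_adjoint, star_one]

/-- `(G ⋄ F)* ⋄ (G ⋄ F)` is `F* ⋄ F` plus the conjugate of `G* ⋄ G` by `I + ΔF`. -/
lemma adjoint_sp_sp (G F : E H K →L[ℂ] E H K) :
    sp (adjoint (sp G F)) (sp G F) =
      sp (adjoint F) F + adjoint (1 + Dl H K * F) * sp (adjoint G) G * (1 + Dl H K * F) := by
  rw [adjoint_sp, adjoint_one_add_Dl_mul]
  simp only [sp]
  noncomm_ring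

lemma sp_adjoint_self_of_central (F G : E H K →L[ℂ] E H K) (hG : G = Dp H K * G * Dp H K) :
    sp (adjoint (sp G F)) (sp G F) = sp (adjoint F) F + adjoint G + G := by
  have hGD : G * Dl H K = 0 := by rw [hG, mul_assoc, Dp_mul_Dl, mul_zero]
  have hDG : Dl H K * G = 0 := by
    rw [hG, ← mul_assoc, ← mul_assoc, Dl_mul_Dp, zero_mul, zero_mul]
  have hDG' : adjoint G * Dl H K = 0 := by
    rw [← adjoint_Dl, ← adjoint_mul, hDG, map_zero]
  have hGF : sp G F = G + F := by rw [sp, hGD, zero_mul, add_zero]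
  rw [hGF, sp, sp, map_add, add_mul, hDG', zero_add, mul_add, mul_assoc _ _ G, hDG, mul_zero]
  abel

lemma Dp_conj (F : E H K →L[ℂ] E H K) :
    adjoint (1 + Dl H K * F) * Dp H K * (1 + Dl H K * F) = Dp H K := by
  rw [adjoint_one_add_Dl_mul, add_mul, one_mul, mul_assoc, Dl_mul_Dp, mul_zero, add_zero,
    mul_add, mul_one, ← mul_assoc, Dp_mul_Dl, zero_mul, add_zero]

lemma opLe_sp_adjoint_self (F G : E H K →L[ℂ] E H K) (c : ℂ)
    (hG : opLe (sp (adjoint G) G) (c • Dp H K)) :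
    opLe (sp (adjoint (sp G F)) (sp G F)) (sp (adjoint F) F + c • Dp H K) := by
  have h := hG.adjoint_conj (1 + Dl H K * F)
  have key : adjoint (1 + Dl H K * F) * (c • Dp H K - sp (adjoint G) G) * (1 + Dl H K * F) =
      sp (adjoint F) F + c • Dp H K - sp (adjoint (sp G F)) (sp G F) := by
    rw [adjoint_sp_sp, mul_sub, sub_mul, mul_smul_comm, smul_mul_assoc, Dp_conj]
    abel
  rw [opLe, ← key]
  exact h

lemma sp_adjoint_self_of_isometric (F G : E H K →L[ℂ] E H K) (hG : sp (adjoint G) G = 0) :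
    sp (adjoint (sp G F)) (sp G F) = sp (adjoint F) F := by
  rw [adjoint_sp_sp, hG, mul_zero, zero_mul, add_zero]

lemma opLe.sp_of_opLe_smul {F₁ F₂ : E H K →L[ℂ] E H K} {c₁ c₂ : ℂ}
    (h₁ : opLe (sp (adjoint F₁) F₁) (c₁ • Dp H K))
    (h₂ : opLe (sp (adjoint F₂) F₂) (c₂ • Dp H K)) :
    opLe (sp (adjoint (sp F₁ F₂)) (sp F₁ F₂)) ((c₁ + c₂) • Dp H K) := by
  have h := (opLe_sp_adjoint_self F₂ F₁ c₁ h₁).add h₂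
  have hsmul : (c₁ + c₂) • Dp H K = c₁ • Dp H K + c₂ • Dp H K :=
    ContinuousLinearMap.ext fun x => add_smul c₁ c₂ (Dp H K x)
  rw [opLe, hsmul]
  convert h using 1
  abel

/-- Behaviour of `G ⋄ F` under `(·)* ⋄ (·)` for `G` central,
quasicontractive or isometric; consequently `𝔠`, `𝔦`, `𝔲` and `𝔮𝔠` are closed under
the series product. -/
theorem series_product_classes_closed :
    (∀ F G : E H K →L[ℂ] E H K, G = Dp H K * G * Dp H K →
      sp (adjoint (sp G F)) (sp G F) = sp (adjoint F) F + adjoint G + G) ∧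
    (∀ (F G : E H K →L[ℂ] E H K) (β : ℝ),
      opLe (sp (adjoint G) G) (((2 * β : ℝ) : ℂ) • Dp H K) →
      opLe (sp (adjoint (sp G F)) (sp G F))
        (sp (adjoint F) F + ((2 * β : ℝ) : ℂ) • Dp H K)) ∧
    (∀ F G : E H K →L[ℂ] E H K, sp (adjoint G) G = 0 →
      sp (adjoint (sp G F)) (sp G F) = sp (adjoint F) F) ∧
    (∀ F₁ F₂ : E H K →L[ℂ] E H K,
      opLe (sp (adjoint F₁) F₁) 0 → opLe (sp (adjoint F₂) F₂) 0 →
      opLe (sp (adjoint (sp F₁ F₂)) (sp F₁ F₂)) 0) ∧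
    (∀ F₁ F₂ : E H K →L[ℂ] E H K,
      sp (adjoint F₁) F₁ = 0 → sp (adjoint F₂) F₂ = 0 →
      sp (adjoint (sp F₁ F₂)) (sp F₁ F₂) = 0) ∧
    (∀ F₁ F₂ : E H K →L[ℂ] E H K,
      (sp (adjoint F₁) F₁ = 0 ∧ sp F₁ (adjoint F₁) = 0) →
      (sp (adjoint F₂) F₂ = 0 ∧ sp F₂ (adjoint F₂) = 0) →
      (sp (adjoint (sp F₁ F₂)) (sp F₁ F₂) = 0 ∧ sp (sp F₁ F₂) (adjoint (sp F₁ F₂)) = 0)) ∧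
    (∀ (F₁ F₂ : E H K →L[ℂ] E H K) (β₁ β₂ : ℝ),
      opLe (sp (adjoint F₁) F₁) (((2 * β₁ : ℝ) : ℂ) • Dp H K) →
      opLe (sp (adjoint F₂) F₂) (((2 * β₂ : ℝ) : ℂ) • Dp H K) →
      opLe (sp (adjoint (sp F₁ F₂)) (sp F₁ F₂))
        (((2 * (β₁ + β₂) : ℝ) : ℂ) • Dp H K)) := by
  refine ⟨sp_adjoint_self_of_central, fun F G β => opLe_sp_adjoint_self F G _,
    sp_adjoint_self_of_isometric, fun F₁ F₂ h₁ h₂ => ?_, fun F₁ F₂ h₁ h₂ => ?_,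
    fun F₁ F₂ h₁ h₂ => ⟨?_, ?_⟩, fun F₁ F₂ β₁ β₂ h₁ h₂ => ?_⟩
  · have hzero : (0 : ℂ) • Dp H K = 0 :=
      ContinuousLinearMap.ext fun x => zero_smul ℂ (Dp H K x)
    rw [← hzero] at h₁ h₂ ⊢
    simpa only [add_zero] using h₁.sp_of_opLe_smul h₂
  · rw [sp_adjoint_self_of_isometric _ _ h₁, h₂]
  · rw [sp_adjoint_self_of_isometric _ _ h₁.1, h₂.1]
  · have h := sp_adjoint_self_of_isometric (adjoint F₁) (adjoint F₂)
      (by rw [adjoint_adjoint, h₂.2])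
    rwa [← adjoint_sp, adjoint_adjoint, adjoint_adjoint, h₁.2] at h
  · rw [mul_add, Complex.ofReal_add]
    exact h₁.sp_of_opLe_smul h₂

end QS
end
end

section
/- Let F ∈ B(𝔥⊕𝔎). Then: (i) F* ⋄ F = 0 if and only if F has block matrix form [iH − ½L*L, −L*C; L, C − I] for some selfadjoint H ∈ B(𝔥), some L ∈ B(𝔥;𝔎) and some isometry C ∈ B(𝔎) (C*C = I); (ii) F ⋄ F* = 0 if and only if F has block matrix form [iH − ½MM*, M; −CM*, C − I] for some selfadjoint H ∈ B(𝔥), some M ∈ B(𝔎;𝔥) and some coisometry C ∈ B(𝔎) (CC* = I). -/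
noncomputable section

open ContinuousLinearMap

namespace QS

variable (H K : Type*) [NormedAddCommGroup H] [InnerProductSpace ℂ H] [CompleteSpace H]
  [NormedAddCommGroup K] [InnerProductSpace ℂ K] [CompleteSpace K]

variable {H K}

omit [CompleteSpace H] [CompleteSpace K] in
theorem hasBlock_self (F : E H K →L[ℂ] E H K) :
    HasBlock F (prH H K ∘L F ∘L inH H K) (prH H K ∘L F ∘L inK H K)
      (prK H K ∘L F ∘L inH H K) (prK H K ∘L F ∘L inK H K) := by
  intro u ζ
  have h : (WithLp.equiv 2 (H × K)).symm (u, ζ) = inH H K u + inK H K ζ := by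
    apply (WithLp.equiv 2 (H × K)).injective
    ext <;> simp [inH, inK, eE]
  rw [h, map_add]
  rfl

omit [CompleteSpace H] [CompleteSpace K] in
theorem HasBlock.eq_zero_iff {F : E H K →L[ℂ] E H K} {A : H →L[ℂ] H} {M : K →L[ℂ] H}
    {L : H →L[ℂ] K} {N : K →L[ℂ] K} (h : HasBlock F A M L N) :
    F = 0 ↔ A = 0 ∧ M = 0 ∧ L = 0 ∧ N = 0 := by
  constructor
  · rintro rfl
    have h₁ (u : H) := congrArg (WithLp.equiv 2 (H × K)) (h u 0)
    have h₂ (ζ : K) := congrArg (WithLp.equiv 2 (H × K)) (h 0 ζ)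
    simp only [zero_apply, map_zero, add_zero, zero_add, Equiv.apply_symm_apply] at h₁ h₂
    exact ⟨ext fun u => (congrArg Prod.fst (h₁ u)).symm,
      ext fun ζ => (congrArg Prod.fst (h₂ ζ)).symm,
      ext fun u => (congrArg Prod.snd (h₁ u)).symm,
      ext fun ζ => (congrArg Prod.snd (h₂ ζ)).symm⟩
  · rintro ⟨rfl, rfl, rfl, rfl⟩
    ext1 x
    refine (h x.fst x.snd).trans ?_
    simp

theorem HasBlock.adjoint {F : E H K →L[ℂ] E H K} {A : H →L[ℂ] H} {M : K →L[ℂ] H}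
    {L : H →L[ℂ] K} {N : K →L[ℂ] K} (h : HasBlock F A M L N) :
    HasBlock (adjoint F) (adjoint A) (adjoint L) (adjoint M) (adjoint N) := by
  intro u ζ
  refine ext_inner_right ℂ fun y => ?_
  rw [adjoint_inner_left]
  have hy : F y = _ := h y.fst y.snd
  rw [hy]
  simp [WithLp.prod_inner_apply, adjoint_inner_left, inner_add_left, inner_add_right]
  ring

omit [CompleteSpace H] [CompleteSpace K] in
theorem HasBlock.sp {F G : E H K →L[ℂ] E H K} {A A' : H →L[ℂ] H} {M M' : K →L[ℂ] H}
    {L L' : H →L[ℂ] K} {N N' : K →L[ℂ] K} (hF : HasBlock F A M L N)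
    (hG : HasBlock G A' M' L' N') :
    HasBlock (sp F G) (A + M ∘L L' + A') (M + M ∘L N' + M')
      (L + N ∘L L' + L') (N + N ∘L N' + N') := by
  intro u ζ
  have hD (x : H) (y : K) : Dl H K ((WithLp.equiv 2 (H × K)).symm (x, y)) =
      (WithLp.equiv 2 (H × K)).symm (0, y) := rfl
  simp only [QS.sp, add_apply, mul_def, comp_apply, hF u ζ, hG u ζ, hD, hF 0 (L' u + N' ζ)]
  apply (WithLp.equiv 2 (H × K)).injective
  ext <;> simp <;> abel

theorem hasBlock_adjoint_iff {F : E H K →L[ℂ] E H K} {A : H →L[ℂ] H} {M : K →L[ℂ] H}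
    {L : H →L[ℂ] K} {N : K →L[ℂ] K} :
    HasBlock (adjoint F) A M L N ↔
      HasBlock F (adjoint A) (adjoint L) (adjoint M) (adjoint N) := by
  refine ⟨fun h => ?_, fun h => ?_⟩ <;> simpa using h.adjoint

theorem sp_adjoint_self_eq_zero_iff (F : E H K →L[ℂ] E H K) :
    sp (adjoint F) F = 0 ↔
      ∃ (Hs : H →L[ℂ] H) (L : H →L[ℂ] K) (C : K →L[ℂ] K),
        IsSelfAdjoint Hs ∧ adjoint C * C = 1 ∧
        HasBlock F (Complex.I • Hs - (2⁻¹ : ℂ) • (adjoint L ∘L L))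
          (-(adjoint L ∘L C)) L (C - 1) := by
  have adj_one : adjoint (1 : K →L[ℂ] K) = 1 := star_one _
  constructor
  · intro h
    obtain ⟨A, M, L, N, hF⟩ : ∃ A M L N, HasBlock F A M L N := ⟨_, _, _, _, hasBlock_self F⟩
    obtain ⟨hA, hM, -, hN⟩ := (hF.adjoint.sp hF).eq_zero_iff.1 h
    have hA' : adjoint A = -(adjoint L ∘L L) - A := by
      rw [← sub_eq_zero, ← hA]; abel
    refine ⟨-Complex.I • (A + (2⁻¹ : ℂ) • (adjoint L ∘L L)), L, N + 1, ?_, ?_, ?_⟩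
    · rw [isSelfAdjoint_iff']
      simp only [map_add, map_smulₛₗ, adjoint_comp, adjoint_adjoint, hA', map_neg, map_inv₀,
        Complex.conj_I, map_ofNat]
      module
    · rw [map_add, adj_one, ← sub_eq_zero, ← hN]
      simp only [← mul_def]
      noncomm_ring
    · convert hF using 1
      · rw [smul_smul]; simp
      · rw [← sub_eq_zero, ← neg_eq_zero, ← hM]
        simp [comp_add, one_def]
        abel
      · simp
  · rintro ⟨Hs, L, C, hs, hC, hF⟩
    rw [isSelfAdjoint_iff'] at hs
    refine (hF.adjoint.sp hF).eq_zero_iff.2 ⟨?_, ?_, ?_, ?_⟩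
    · simp only [map_sub, map_smulₛₗ, adjoint_comp, adjoint_adjoint, hs, map_inv₀,
        Complex.conj_I, map_ofNat]
      module
    · simp [comp_sub, one_def]
    · rw [map_sub, adj_one]
      simp [sub_comp, one_def, adjoint_comp]
      abel
    · rw [map_sub, adj_one, ← sub_eq_zero.2 hC]
      simp only [← mul_def]
      noncomm_ring

/-- Characterisation of isometric (`F* ⋄ F = 0`) and coisometric
(`F ⋄ F* = 0`) stochastic generators. -/
theorem isometric_coisometric_characterisation (F : E H K →L[ℂ] E H K) :
    (sp (adjoint F) F = 0 ↔
      ∃ (Hs : H →L[ℂ] H) (L : H →L[ℂ] K) (C : K →L[ℂ] K),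
        IsSelfAdjoint Hs ∧ adjoint C * C = 1 ∧
        HasBlock F (Complex.I • Hs - (2⁻¹ : ℂ) • (adjoint L ∘L L))
          (-(adjoint L ∘L C)) L (C - 1)) ∧
    (sp F (adjoint F) = 0 ↔
      ∃ (Hs : H →L[ℂ] H) (M : K →L[ℂ] H) (C : K →L[ℂ] K),
        IsSelfAdjoint Hs ∧ C * adjoint C = 1 ∧
        HasBlock F (Complex.I • Hs - (2⁻¹ : ℂ) • (M ∘L adjoint M))
          M (-(C ∘L adjoint M)) (C - 1)) := by
  refine ⟨sp_adjoint_self_eq_zero_iff F, ?_⟩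
  have h := sp_adjoint_self_eq_zero_iff (adjoint F)
  rw [adjoint_adjoint] at h
  rw [h]
  have adj_one : adjoint (1 : K →L[ℂ] K) = 1 := star_one _
  constructor
  · rintro ⟨Hs, L, C, hs, hC, hF⟩
    rw [hasBlock_adjoint_iff] at hF
    refine ⟨-Hs, adjoint L, adjoint C, hs.neg, by rwa [adjoint_adjoint], ?_⟩
    rw [isSelfAdjoint_iff'] at hs
    simpa [map_smulₛₗ, adjoint_comp, hs, adj_one, Complex.conj_ofNat] using hF
  · rintro ⟨Hs, M, C, hs, hC, hF⟩
    refine ⟨-Hs, adjoint M, adjoint C, hs.neg, by rwa [adjoint_adjoint], ?_⟩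
    rw [isSelfAdjoint_iff'] at hs
    rw [hasBlock_adjoint_iff]
    simpa [map_smulₛₗ, adjoint_comp, hs, adj_one, Complex.conj_ofNat] using hF

end QS
end
end

section
/- Let S ⊆ B(𝔥⊕𝔎⊕𝔥) denote the set of operators having block matrix form [I, M, K; 0, Q, L; 0, 0, I] with K ∈ B(𝔥), M ∈ B(𝔎;𝔥), L ∈ B(𝔥;𝔎), Q ∈ B(𝔎), and let Ξ ∈ B(𝔥⊕𝔎⊕𝔥) be the unitary with block matrix form [0, 0, I; 0, I, 0; I, 0, 0]. Then the map φ : B(𝔥⊕𝔎) → B(𝔥⊕𝔎⊕𝔥) sending the operator with block matrix form [K, M; L, Q − I] to the operator with block matrix form [I, M, K; 0, Q, L; 0, 0, I] is a bijection onto S satisfying φ(F₁ ⋄ F₂) = φ(F₁)φ(F₂) (operator composition), φ(F*) = Ξ φ(F)* Ξ, and φ(0) = I, for all F, F₁, F₂ ∈ B(𝔥⊕𝔎). In particular, S is closed under operator composition and under the involution T ↦ ΞT*Ξ. -/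
noncomputable section

open ContinuousLinearMap

namespace QS

variable (H K : Type*) [NormedAddCommGroup H] [InnerProductSpace ℂ H] [CompleteSpace H]
  [NormedAddCommGroup K] [InnerProductSpace ℂ K] [CompleteSpace K]

variable {H K}

variable (H K)

/-- `𝔥 ⊕ 𝔎 ⊕ 𝔥` (as `𝔥 ⊕ (𝔎 ⊕ 𝔥)`). -/
abbrev G3 := WithLp 2 (H × WithLp 2 (K × H))

/-- The element `u ⊕ ζ ⊕ v` of `𝔥 ⊕ 𝔎 ⊕ 𝔥`. -/
def mk3 (u : H) (ζ : K) (v : H) : G3 H K :=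
  (WithLp.equiv 2 (H × WithLp 2 (K × H))).symm (u, (WithLp.equiv 2 (K × H)).symm (ζ, v))

/-- `T ∈ B(𝔥⊕𝔎⊕𝔥)` has block matrix form `[T₁₁ T₁₂ T₁₃; T₂₁ T₂₂ T₂₃; T₃₁ T₃₂ T₃₃]`. -/
def HasBlock3 (T : G3 H K →L[ℂ] G3 H K)
    (T11 : H →L[ℂ] H) (T12 : K →L[ℂ] H) (T13 : H →L[ℂ] H)
    (T21 : H →L[ℂ] K) (T22 : K →L[ℂ] K) (T23 : H →L[ℂ] K)
    (T31 : H →L[ℂ] H) (T32 : K →L[ℂ] H) (T33 : H →L[ℂ] H) : Prop :=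
  ∀ (u : H) (ζ : K) (v : H),
    T (mk3 H K u ζ v) =
      mk3 H K (T11 u + T12 ζ + T13 v) (T21 u + T22 ζ + T23 v) (T31 u + T32 ζ + T33 v)

/-- First inclusion `𝔥 → 𝔥 ⊕ 𝔎 ⊕ 𝔥`. -/
def i1 : H →L[ℂ] G3 H K := inH H (WithLp 2 (K × H))
/-- Second inclusion `𝔎 → 𝔥 ⊕ 𝔎 ⊕ 𝔥`. -/
def i2 : K →L[ℂ] G3 H K := (inK H (WithLp 2 (K × H))) ∘L (inH K H)
/-- Third inclusion `𝔥 → 𝔥 ⊕ 𝔎 ⊕ 𝔥`. -/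
def i3 : H →L[ℂ] G3 H K := (inK H (WithLp 2 (K × H))) ∘L (inK K H)
/-- First projection `𝔥 ⊕ 𝔎 ⊕ 𝔥 → 𝔥`. -/
def p1 : G3 H K →L[ℂ] H := prH H (WithLp 2 (K × H))
/-- Second projection `𝔥 ⊕ 𝔎 ⊕ 𝔥 → 𝔎`. -/
def p2 : G3 H K →L[ℂ] K := (prH K H) ∘L (prK H (WithLp 2 (K × H)))
/-- Third projection `𝔥 ⊕ 𝔎 ⊕ 𝔥 → 𝔥`. -/
def p3 : G3 H K →L[ℂ] H := (prK K H) ∘L (prK H (WithLp 2 (K × H)))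

/-- The operator on `𝔥 ⊕ 𝔎 ⊕ 𝔥` with the given `3 × 3` block matrix form. -/
def blockOf3 (T11 : H →L[ℂ] H) (T12 : K →L[ℂ] H) (T13 : H →L[ℂ] H)
    (T21 : H →L[ℂ] K) (T22 : K →L[ℂ] K) (T23 : H →L[ℂ] K)
    (T31 : H →L[ℂ] H) (T32 : K →L[ℂ] H) (T33 : H →L[ℂ] H) : G3 H K →L[ℂ] G3 H K :=
  i1 H K ∘L T11 ∘L p1 H K + i1 H K ∘L T12 ∘L p2 H K + i1 H K ∘L T13 ∘L p3 H K +
    i2 H K ∘L T21 ∘L p1 H K + i2 H K ∘L T22 ∘L p2 H K + i2 H K ∘L T23 ∘L p3 H K +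
    i3 H K ∘L T31 ∘L p1 H K + i3 H K ∘L T32 ∘L p2 H K + i3 H K ∘L T33 ∘L p3 H K

/-- The map `φ : B(𝔥⊕𝔎) → B(𝔥⊕𝔎⊕𝔥)` sending the operator with block matrix form
`[K, M; L, Q − I]` to the operator with block matrix form `[I, M, K; 0, Q, L; 0, 0, I]`. -/
def phi (F : E H K →L[ℂ] E H K) : G3 H K →L[ℂ] G3 H K :=
  blockOf3 H K 1 (prH H K ∘L F ∘L inK H K) (prH H K ∘L F ∘L inH H K)
    0 (prK H K ∘L F ∘L inK H K + 1) (prK H K ∘L F ∘L inH H K)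
    0 0 1

/-- The unitary `Ξ` with block matrix form `[0, 0, I; 0, I, 0; I, 0, 0]`. -/
def Xi : G3 H K →L[ℂ] G3 H K := blockOf3 H K 0 0 1 0 1 0 1 0 0

/-- The set `𝒮` of operators with block matrix form `[I, M, K; 0, Q, L; 0, 0, I]`. -/
def S3 : Set (G3 H K →L[ℂ] G3 H K) :=
  {T | ∃ (Kc : H →L[ℂ] H) (M : K →L[ℂ] H) (L : H →L[ℂ] K) (Q : K →L[ℂ] K),
    HasBlock3 H K T 1 M Kc 0 Q L 0 0 1}

section Coordinates

variable {U V : Type*}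

theorem exists_eq_mk3 (x : G3 U V) : ∃ u ζ v, x = mk3 U V u ζ v :=
  ⟨x.fst, x.snd.fst, x.snd.snd, rfl⟩

theorem exists_eq_toLp (x : E U V) : ∃ u ζ, x = WithLp.toLp 2 (u, ζ) :=
  ⟨x.fst, x.snd, rfl⟩

variable [NormedAddCommGroup U] [InnerProductSpace ℂ U]
  [NormedAddCommGroup V] [InnerProductSpace ℂ V]

theorem inner_mk3 (u u' : U) (ζ ζ' : V) (v v' : U) :
    inner ℂ (mk3 U V u ζ v) (mk3 U V u' ζ' v') =
      inner ℂ u u' + inner ℂ ζ ζ' + inner ℂ v v' := by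
  simp [mk3, WithLp.prod_inner_apply, add_assoc]

theorem phi_mk3 (F : E U V →L[ℂ] E U V) (u : U) (ζ : V) (v : U) :
    phi U V F (mk3 U V u ζ v) =
      mk3 U V (u + (F (WithLp.toLp 2 (v, ζ))).fst) (ζ + (F (WithLp.toLp 2 (v, ζ))).snd) v := by
  have key : (WithLp.toLp 2 (v, ζ) : E U V) = WithLp.toLp 2 (v, 0) + WithLp.toLp 2 (0, ζ) := by
    rw [← WithLp.toLp_add]; simp
  rw [key, map_add]
  refine WithLp.ofLp_injective 2 (Prod.ext ?_ (WithLp.ofLp_injective 2 (Prod.ext ?_ ?_))) <;>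
    simp [phi, blockOf3, i1, i2, i3, p1, p2, p3, inH, inK, prH, prK, eE, mk3] <;> abel

theorem Xi_mk3 (u : U) (ζ : V) (v : U) : Xi U V (mk3 U V u ζ v) = mk3 U V v ζ u := by
  refine WithLp.ofLp_injective 2 (Prod.ext ?_ (WithLp.ofLp_injective 2 (Prod.ext ?_ ?_))) <;>
    simp [Xi, blockOf3, i1, i2, i3, p1, p2, p3, inH, inK, prH, prK, eE, mk3]

theorem inner_Xi_left (x y : G3 U V) : inner ℂ (Xi U V x) y = inner ℂ x (Xi U V y) := by
  obtain ⟨u, ζ, v, rfl⟩ := exists_eq_mk3 x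
  obtain ⟨u', ζ', v', rfl⟩ := exists_eq_mk3 y
  simp only [Xi_mk3, inner_mk3]
  ring

theorem blockOf_toLp (A : U →L[ℂ] U) (M : V →L[ℂ] U) (L : U →L[ℂ] V) (N : V →L[ℂ] V)
    (u : U) (ζ : V) :
    blockOf A M L N (WithLp.toLp 2 (u, ζ)) = WithLp.toLp 2 (A u + M ζ, L u + N ζ) := by
  refine WithLp.ofLp_injective 2 (Prod.ext ?_ ?_) <;> simp [blockOf, inH, inK, prH, prK, eE]

theorem Dl_apply (x : E U V) : Dl U V x = WithLp.toLp 2 (0, x.snd) := by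
  simp [Dl, inK, prK, eE]

theorem phi_injective : Function.Injective (phi U V) := by
  intro F₁ F₂ h
  ext1 x
  obtain ⟨u, ζ, rfl⟩ := exists_eq_toLp x
  have hx := congrArg (fun T => T (mk3 U V 0 ζ u)) h
  simp only [phi_mk3] at hx
  simpa [mk3, WithLp.ext_iff, Prod.ext_iff] using hx

theorem range_phi : Set.range (phi U V) = S3 U V := by
  ext T
  constructor
  · rintro ⟨F, rfl⟩
    refine ⟨prH U V ∘L F ∘L inH U V, prH U V ∘L F ∘L inK U V, prK U V ∘L F ∘L inH U V,
      prK U V ∘L F ∘L inK U V + 1, fun u ζ v => ?_⟩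
    refine WithLp.ofLp_injective 2 (Prod.ext ?_ (WithLp.ofLp_injective 2 (Prod.ext ?_ ?_))) <;>
      simp [phi, blockOf3, i1, i2, i3, p1, p2, p3, inH, inK, prH, prK, eE, mk3]
  · rintro ⟨A, M, L, Q, hT⟩
    refine ⟨blockOf A M L (Q - 1), ?_⟩
    ext1 x
    obtain ⟨u, ζ, v, rfl⟩ := exists_eq_mk3 x
    rw [hT, phi_mk3, blockOf_toLp]
    congr 1 <;> simp <;> abel

theorem phi_sp (F₁ F₂ : E U V →L[ℂ] E U V) :
    phi U V (sp F₁ F₂) = phi U V F₁ * phi U V F₂ := by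
  ext1 x
  obtain ⟨u, ζ, v, rfl⟩ := exists_eq_mk3 x
  have key : (WithLp.toLp 2 (v, ζ + (F₂ (WithLp.toLp 2 (v, ζ))).snd) : E U V) =
      WithLp.toLp 2 (v, ζ) + Dl U V (F₂ (WithLp.toLp 2 (v, ζ))) := by
    rw [Dl_apply, ← WithLp.toLp_add]
    simp
  simp only [mul_apply_eq_comp, phi_mk3, key, map_add, sp, add_apply,
    WithLp.add_fst, WithLp.add_snd]
  congr 1 <;> abel

theorem phi_zero : phi U V 0 = 1 := by
  ext1 x
  obtain ⟨u, ζ, v, rfl⟩ := exists_eq_mk3 x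
  simp [phi_mk3]

end Coordinates

variable {H K}

theorem phi_adjoint (F : E H K →L[ℂ] E H K) :
    phi H K (adjoint F) = Xi H K * adjoint (phi H K F) * Xi H K := by
  ext1 x
  refine ext_inner_right ℂ fun y => ?_
  obtain ⟨u, ζ, v, rfl⟩ := exists_eq_mk3 x
  obtain ⟨u', ζ', v', rfl⟩ := exists_eq_mk3 y
  have key : inner ℂ (adjoint F (WithLp.toLp 2 (v, ζ))).fst u' +
        inner ℂ (adjoint F (WithLp.toLp 2 (v, ζ))).snd ζ' =
      inner ℂ v (F (WithLp.toLp 2 (u', ζ'))).fst +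
        inner ℂ ζ (F (WithLp.toLp 2 (u', ζ'))).snd :=
    adjoint_inner_left F (WithLp.toLp 2 (u', ζ')) (WithLp.toLp 2 (v, ζ))
  simp only [mul_apply_eq_comp, inner_Xi_left, adjoint_inner_left, phi_mk3, Xi_mk3, inner_mk3,
    inner_add_left, inner_add_right]
  linear_combination key

variable (H K)

/-- `φ` is a bijection from `B(𝔥⊕𝔎)` onto `𝒮`, intertwining the series
product with operator composition, the adjoint with the involution `T ↦ Ξ T* Ξ`, and
sending `0` to `I`; in particular `𝒮` is closed under composition and this involution. -/
theorem phi_star_monoid_isomorphism :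
    Function.Injective (phi H K) ∧
    Set.range (phi H K) = S3 H K ∧
    (∀ F₁ F₂ : E H K →L[ℂ] E H K, phi H K (sp F₁ F₂) = phi H K F₁ * phi H K F₂) ∧
    (∀ F : E H K →L[ℂ] E H K,
      phi H K (adjoint F) = Xi H K * adjoint (phi H K F) * Xi H K) ∧
    phi H K 0 = 1 ∧
    (∀ T₁ ∈ S3 H K, ∀ T₂ ∈ S3 H K, T₁ * T₂ ∈ S3 H K) ∧
    (∀ T ∈ S3 H K, Xi H K * adjoint T * Xi H K ∈ S3 H K) := by
  refine ⟨phi_injective, range_phi, phi_sp, phi_adjoint, phi_zero, ?_, ?_⟩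
  · simp only [← range_phi]
    rintro _ ⟨F₁, rfl⟩ _ ⟨F₂, rfl⟩
    exact ⟨sp F₁ F₂, phi_sp F₁ F₂⟩
  · simp only [← range_phi]
    rintro _ ⟨F, rfl⟩
    exact ⟨adjoint F, phi_adjoint F⟩

end QS
end
end
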